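/- arXiv:2205.05995 — 7 statements merged into one kernel-verified Lean document; each statement's English description precedes it below -/
import Mathlib

section
/- Let C be any set of propositional connectives (each connective c comes with an arity and a truth function τ_c : {0,1}^{arity(c)} → {0,1}). Then FOILS(C) = FOCDS(C) if and only if every connective in C is supermultiplicative. -/
open Classical

open Classical

/-- A signature: a set of propositional connectives, each with an arity and a
truth function `{0,1}^arity → {0,1}` (represented with `Bool`). -/
structure Signature : Type 1 where
  Conn : Type
  arity : Conn → ℕ
  tt : (c : Conn) → (Fin (arity c) → Bool) → Bool

/-- Predicate symbols: for each pair `(k, n)` a predicate symbol of arity `n`. -/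
abbrev PredSym : Type := ℕ × ℕ

/-- The arity of a predicate symbol. -/
abbrev parity (p : PredSym) : ℕ := p.2

/-- Predicate formulas over a signature: atomic formulas `p(x₁,…,xₙ)` (with
individual variables drawn from `ℕ`), applications of connectives, and the
quantifiers `∀x`, `∃x`. -/
inductive Formula (sig : Signature) : Type where
  | atom (p : PredSym) (args : Fin (parity p) → ℕ)
  | conn (c : sig.Conn) (args : Fin (sig.arity c) → Formula sig)
  | all (x : ℕ) (φ : Formula sig)
  | ex (x : ℕ) (φ : Formula sig)

/-- A Kripke model with worlds `W` and individuals drawn from `U`. -/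
structure Kripke (sig : Signature) (W U : Type) : Type where
  le : W → W → Prop
  le_refl : ∀ w, le w w
  le_trans : ∀ {w v u}, le w v → le v u → le w u
  D : W → Set U
  D_nonempty : ∀ w, (D w).Nonempty
  D_mono : ∀ {w v}, le w v → D w ⊆ D v
  I : (w : W) → (p : PredSym) → (Fin (parity p) → U) → Bool
  hered : ∀ {w v}, le w v → ∀ (p : PredSym) (a : Fin (parity p) → U),
      (∀ i, a i ∈ D w) → I w p a ≤ I v p a

/-- The value `‖φ‖_{K,w}^ρ ∈ {0,1}` of a formula at a world under an assignment. -/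
noncomputable def val {sig : Signature} {W U : Type} (K : Kripke sig W U) :
    Formula sig → W → (ℕ → U) → Bool
  | .atom p args, w, ρ => K.I w p (fun i => ρ (args i))
  | .conn c args, w, ρ =>
      decide (∀ v, K.le w v → sig.tt c (fun i => val K (args i) v ρ) = true)
  | .all x φ, w, ρ =>
      decide (∀ v, K.le w v → ∀ a ∈ K.D v, val K φ v (Function.update ρ x a) = true)
  | .ex x φ, w, ρ =>
      decide (∃ a ∈ K.D w, val K φ w (Function.update ρ x a) = true)

/-- A sequent `Γ ⇒ Δ` (two sets of formulas) is valid in a Kripke model if at no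
world and assignment do all formulas of `Γ` get value 1 and all formulas of `Δ`
get value 0. -/
def SeqValid {sig : Signature} {W U : Type} (K : Kripke sig W U)
    (Γ Δ : Set (Formula sig)) : Prop :=
  ∀ (w : W) (ρ : ℕ → U), (∀ x, ρ x ∈ K.D w) →
    ¬ ((∀ φ ∈ Γ, val K φ w ρ = true) ∧ (∀ φ ∈ Δ, val K φ w ρ = false))

/-- A Kripke model has constant domains if all worlds have the same domain. -/
def ConstantDomain {sig : Signature} {W U : Type} (K : Kripke sig W U) : Prop :=
  ∀ w v, K.D w = K.D v

/-- `Γ ⇒ Δ` is Kripke-valid (belongs to FOILS). -/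
def FOILS (sig : Signature) (Γ Δ : Set (Formula sig)) : Prop :=
  ∀ (W U : Type) (K : Kripke sig W U), SeqValid K Γ Δ

/-- `Γ ⇒ Δ` is valid in all constant domain Kripke models (belongs to FOCDS). -/
def FOCDS (sig : Signature) (Γ Δ : Set (Formula sig)) : Prop :=
  ∀ (W U : Type) (K : Kripke sig W U), ConstantDomain K → SeqValid K Γ Δ

/-- `Γ ⇒ Δ` is valid in all one-world Kripke models, i.e. classically valid
(belongs to FOCLS). -/
def FOCLS (sig : Signature) (Γ Δ : Set (Formula sig)) : Prop :=
  ∀ (U : Type) (K : Kripke sig Unit U), SeqValid K Γ Δ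

/-- A truth function is supermultiplicative if `f(a) = f(b) = 1` implies
`f(a ⊓ b) = 1`, where `⊓` is the componentwise minimum. -/
def Supermultiplicative {n : ℕ} (f : (Fin n → Bool) → Bool) : Prop :=
  ∀ a b : Fin n → Bool, f a = true → f b = true → f (fun i => a i && b i) = true

/-- A truth function is monotonic if `a ⊑ b` (componentwise) implies `f a ≤ f b`. -/
def Monotonic {n : ℕ} (f : (Fin n → Bool) → Bool) : Prop :=
  ∀ a b : Fin n → Bool, (∀ i, a i ≤ b i) → f a ≤ f b


namespace Kripke

variable {sig : Signature} {W U : Type} (K : Kripke sig W U)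

theorem val_atom (p : PredSym) (args : Fin (parity p) → ℕ) (w : W) (ρ : ℕ → U) :
    val K (.atom p args) w ρ = K.I w p (fun i => ρ (args i)) := by
  rw [val]

theorem val_atom_nullary (k : ℕ) (args : Fin (parity (k, 0)) → ℕ) (w : W) (ρ ρ' : ℕ → U) :
    val K (.atom (k, 0) args) w ρ = val K (.atom (k, 0) args) w ρ' := by
  rw [val_atom, val_atom]
  exact congrArg (K.I w (k, 0)) (funext fun i => i.elim0)

theorem val_conn_iff (c : sig.Conn) (args : Fin (sig.arity c) → Formula sig) (w : W)
    (ρ : ℕ → U) : val K (.conn c args) w ρ = true ↔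
      ∀ v, K.le w v → sig.tt c (fun i => val K (args i) v ρ) = true := by
  rw [val, decide_eq_true_iff]

theorem val_all_iff (x : ℕ) (φ : Formula sig) (w : W) (ρ : ℕ → U) :
    val K (.all x φ) w ρ = true ↔
      ∀ v, K.le w v → ∀ a ∈ K.D v, val K φ v (Function.update ρ x a) = true := by
  rw [val, decide_eq_true_iff]

theorem val_ex_iff (x : ℕ) (φ : Formula sig) (w : W) (ρ : ℕ → U) :
    val K (.ex x φ) w ρ = true ↔
      ∃ a ∈ K.D w, val K φ w (Function.update ρ x a) = true := by
  rw [val, decide_eq_true_iff]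

theorem update_mem {S : Set U} {ρ : ℕ → U} (hρ : ∀ y, ρ y ∈ S) (x : ℕ) {a : U} (ha : a ∈ S)
    (y : ℕ) : Function.update ρ x a y ∈ S := by
  by_cases h : y = x
  · subst h; simpa using ha
  · simpa [h] using hρ y

theorem val_persistent (φ : Formula sig) {w v : W} (hwv : K.le w v) {ρ : ℕ → U}
    (hρ : ∀ x, ρ x ∈ K.D w) (h : val K φ w ρ = true) : val K φ v ρ = true := by
  induction φ generalizing ρ with
  | atom p args =>
    rw [val_atom] at h ⊢
    exact K.hered hwv p _ (fun i => hρ _) h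
  | conn c args _ =>
    rw [val_conn_iff] at h ⊢
    exact fun u hu => h u (K.le_trans hwv hu)
  | all x φ _ =>
    rw [val_all_iff] at h ⊢
    exact fun u hu => h u (K.le_trans hwv hu)
  | ex x φ ih =>
    rw [val_ex_iff] at h ⊢
    obtain ⟨a, ha, hφ⟩ := h
    exact ⟨a, K.D_mono hwv ha, ih (update_mem hρ x ha) hφ⟩

/-- Nonempty finite nondecreasing sequences of worlds, listed with the latest world first. -/
def Path : Type := {l : List W // l ≠ [] ∧ l.IsChain (fun a b => K.le b a)}

namespace Path

variable {K}

/-- The number of worlds on a path. -/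
def length (t : K.Path) : ℕ := t.1.length

/-- The latest world of a path. -/
def last (t : K.Path) : W := t.1.head t.2.1

/-- `t` extends `s`. -/
def Extends (s t : K.Path) : Prop := s.1 <:+ t.1

theorem Extends.refl (s : K.Path) : s.Extends s := List.suffix_refl _

theorem Extends.trans {s t r : K.Path} (h : s.Extends t) (h' : t.Extends r) : s.Extends r :=
  List.IsSuffix.trans h h'

theorem Extends.length_le {s t : K.Path} (h : s.Extends t) : s.length ≤ t.length :=
  List.IsSuffix.length_le h

theorem Extends.last_le {s t : K.Path} (h : s.Extends t) : K.le s.last t.last := by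
  obtain ⟨t, ht, hc⟩ := t
  obtain ⟨p, hp⟩ := h
  obtain ⟨s, hs, hsc⟩ := s
  dsimp only at hp
  subst hp
  induction p with
  | nil => exact K.le_refl _
  | cons a p ih =>
    have hne : p ++ s ≠ [] := by simp [hs]
    rw [List.cons_append, List.isChain_cons] at hc
    refine K.le_trans (ih hne hc.2) ?_
    exact hc.1 _ (List.head_mem_head? hne)

/-- The path consisting of a single world. -/
def single (w : W) : K.Path := ⟨[w], by simp, by simp⟩

/-- Extend a path by one further world. -/
def snoc (t : K.Path) (v : W) (h : K.le t.last v) : K.Path :=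
  ⟨v :: t.1, by simp, by
    rw [List.isChain_cons]
    refine ⟨fun y hy => ?_, t.2.2⟩
    rw [List.head?_eq_some_head t.2.1] at hy
    cases hy
    exact h⟩

theorem extends_snoc (t : K.Path) (v : W) (h : K.le t.last v) : t.Extends (t.snoc v h) :=
  List.suffix_cons _ _

theorem last_snoc (t : K.Path) (v : W) (h : K.le t.last v) : (t.snoc v h).last = v := rfl

theorem length_snoc (t : K.Path) (v : W) (h : K.le t.last v) :
    (t.snoc v h).length = t.length + 1 := rfl

theorem exists_extends_last_eq (t : K.Path) (n : ℕ) :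
    ∃ r : K.Path, t.Extends r ∧ n < r.length ∧ r.last = t.last := by
  induction n with
  | zero => exact ⟨t, .refl t, List.length_pos_iff.2 t.2.1, rfl⟩
  | succ n ih =>
    obtain ⟨r, hr, hn, hl⟩ := ih
    refine ⟨r.snoc r.last (K.le_refl _), hr.trans (r.extends_snoc _ _), ?_, hl⟩
    rw [length_snoc]
    omega

/-- The initial segment of a path consisting of its first `n + 1` worlds. -/
def restrict (n : ℕ) (t : K.Path) : K.Path :=
  ⟨t.1.drop (t.1.length - (n + 1)), by
    have := List.length_pos_iff.2 t.2.1
    rw [Ne, List.drop_eq_nil_iff]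
    omega, t.2.2.suffix (List.drop_suffix _ _)⟩

theorem restrict_extends (n : ℕ) (t : K.Path) : (t.restrict n).Extends t :=
  List.drop_suffix _ _

theorem length_restrict {n : ℕ} {t : K.Path} (h : n < t.length) :
    (t.restrict n).length = n + 1 := by
  simp only [length, restrict, List.length_drop] at h ⊢
  omega

theorem restrict_eq_self {n : ℕ} {t : K.Path} (h : t.length ≤ n + 1) : t.restrict n = t := by
  apply Subtype.ext
  simp only [length, restrict] at h ⊢
  rw [Nat.sub_eq_zero_of_le h, List.drop_zero]

theorem Extends.extends_of_length_le {s t r : K.Path} (hs : s.Extends r) (ht : t.Extends r)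
    (h : s.length ≤ t.length) : s.Extends t :=
  List.suffix_of_suffix_length_le hs ht h

theorem Extends.restrict_eq {n : ℕ} {s t : K.Path} (h : s.Extends t) (hn : n < s.length) :
    t.restrict n = s.restrict n := by
  have hlen : (t.restrict n).length = (s.restrict n).length := by
    rw [length_restrict hn, length_restrict (hn.trans_le h.length_le)]
  apply Subtype.ext
  exact ((t.restrict_extends n).extends_of_length_le ((s.restrict_extends n).trans h)
    hlen.le).eq_of_length hlen

end Path

/-- A function on paths is stable beyond `n` if its value on a path of more than `n` worlds
does not change when the path is extended. -/
def Stable {α : Type} (n : ℕ) (u : K.Path → α) : Prop :=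
  ∀ s t : K.Path, s.Extends t → n < s.length → u t = u s

theorem Stable.mono {K : Kripke sig W U} {α : Type} {n m : ℕ} {u : K.Path → α}
    (h : K.Stable n u) (hnm : n ≤ m) : K.Stable m u :=
  fun s t hst hm => h s t hst (hnm.trans_lt hm)

/-- Choice functions on paths that depend only on a bounded initial segment of the path. -/
def Individual : Type :=
  {u : K.Path → U // (∀ t, u t ∈ K.D t.last) ∧ ∃ n, K.Stable n u}

/-- The individual that evaluates `f` at the first `n + 1` worlds of a path. -/
def Individual.ofRestrict (n : ℕ) (f : K.Path → U) (hf : ∀ t, f t ∈ K.D t.last) :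
    K.Individual :=
  ⟨fun t => f (t.restrict n), fun t => K.D_mono (t.restrict_extends n).last_le (hf _), n,
    fun _ _ hst hn => by dsimp only; rw [hst.restrict_eq hn]⟩

theorem Individual.stable_ofRestrict (n : ℕ) (f : K.Path → U) (hf : ∀ t, f t ∈ K.D t.last) :
    K.Stable n (ofRestrict K n f hf).1 :=
  fun _ _ hst hn => by simp only [ofRestrict]; rw [hst.restrict_eq hn]

/-- The constant domain model whose worlds are the paths of `K` and whose individuals are the
choice functions on paths. -/
noncomputable def unfolding : Kripke sig K.Path K.Individual where
  le := Path.Extends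
  le_refl := Path.Extends.refl
  le_trans := Path.Extends.trans
  D _ := Set.univ
  D_nonempty _ := ⟨Individual.ofRestrict K 0 (fun t => (K.D_nonempty t.last).choose)
    fun t => (K.D_nonempty t.last).choose_spec, trivial⟩
  D_mono _ := subset_rfl
  I s p a := decide (∃ n, ∀ t : K.Path, s.Extends t → n < t.length →
    K.I t.last p (fun i => (a i).1 t) = true)
  hered {w v} hwv p a _ := by
    intro h
    rw [decide_eq_true_iff] at h ⊢
    obtain ⟨n, hn⟩ := h
    exact ⟨n, fun t ht => hn t (Path.Extends.trans hwv ht)⟩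

theorem constantDomain_unfolding : ConstantDomain K.unfolding := fun _ _ => rfl

variable {K} in
theorem eval_update (ρ : ℕ → K.Individual) (x : ℕ) (u : K.Individual) (t : K.Path) :
    (fun y => (Function.update ρ x u y).1 t) =
      Function.update (fun y => (ρ y).1 t) x (u.1 t) := by
  funext y
  by_cases h : y = x
  · subst h; simp
  · simp [h]

variable {K} in
theorem stable_update {n m : ℕ} {ρ : ℕ → K.Individual} (hρ : ∀ y, K.Stable n (ρ y).1) (x : ℕ)
    {u : K.Individual} (hu : K.Stable m u.1) (y : ℕ) :
    K.Stable (max n m) (Function.update ρ x u y).1 := by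
  by_cases h : y = x
  · subst h; simpa using hu.mono (le_max_right n m)
  · simpa [h] using (hρ y).mono (le_max_left n m)

variable {K} in
theorem eval_eq {n : ℕ} {ρ : ℕ → K.Individual} (hρ : ∀ y, K.Stable n (ρ y).1) {s t : K.Path}
    (hst : s.Extends t) (hn : n < s.length) :
    (fun y => (ρ y).1 t) = fun y => (ρ y).1 s :=
  funext fun y => hρ y s t hst hn

end Kripke

theorem Supermultiplicative.iInf {n : ℕ} {f : (Fin n → Bool) → Bool}
    (hf : Supermultiplicative f) {ι : Type} [Nonempty ι] (g : ι → Fin n → Bool)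
    (hg : ∀ j, f (g j) = true) : f (fun i => decide (∀ j, g j i = true)) = true := by
  obtain ⟨j₀⟩ := ‹Nonempty ι›
  have key : ∀ l : List ι, f (fun i => decide (∀ j ∈ j₀ :: l, g j i = true)) = true := by
    intro l
    induction l with
    | nil => simpa using hg j₀
    | cons k l ih =>
      have := hf _ _ (hg k) ih
      convert this using 2
      funext i
      rw [Bool.eq_iff_iff]
      simp
      tauto
  have hw : ∀ i, ∃ j, g j i = true → ∀ j, g j i = true := by
    intro i
    by_cases h : ∀ j, g j i = true
    · exact ⟨j₀, fun _ => h⟩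
    · obtain ⟨j, hj⟩ := not_forall.1 h
      exact ⟨j, fun h' => absurd h' hj⟩
  choose k hk using hw
  convert key (List.ofFn k) using 2
  funext i
  rw [decide_eq_decide]
  exact ⟨fun h j _ => h j, fun h => hk i (h _ (by simp [List.mem_ofFn]))⟩

namespace Kripke

variable {sig : Signature} {W U : Type} (K : Kripke sig W U)

theorem val_unfolding_iff (hsig : ∀ c : sig.Conn, Supermultiplicative (sig.tt c))
    (φ : Formula sig) {n : ℕ} {ρ : ℕ → K.Individual} (hρ : ∀ x, K.Stable n (ρ x).1)
    (s : K.Path) :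
    val K.unfolding φ s ρ = true ↔
      ∀ t : K.Path, s.Extends t → n < t.length →
        val K φ t.last (fun x => (ρ x).1 t) = true := by
  induction φ generalizing n ρ s with
  | atom p args =>
    simp only [val_atom, unfolding, decide_eq_true_iff]
    refine ⟨?_, fun h => ⟨n, h⟩⟩
    rintro ⟨m, hm⟩ t hst hn
    obtain ⟨r, htr, hr, hl⟩ := t.exists_extends_last_eq m
    have := hm r (hst.trans htr) hr
    rw [hl] at this
    convert this using 2
    funext i
    exact (hρ _ t r htr hn).symm
  | conn c args ih =>
    simp only [val_conn_iff]
    constructor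
    · intro h t hst hn v hv
      have hs := h (t.snoc v hv) (hst.trans (t.extends_snoc v hv))
      convert hs using 2
      funext i
      rw [Bool.eq_iff_iff, ih i hρ]
      have hn' : n < (t.snoc v hv).length := by rw [Path.length_snoc]; omega
      constructor
      · intro h' r hr _
        rw [eval_eq hρ ((t.extends_snoc v hv).trans hr) hn]
        exact K.val_persistent _ hr.last_le
          (fun x => K.D_mono hv ((ρ x).2.1 t)) h'
      · intro h'
        have := h' _ (.refl _) hn'
        rwa [eval_eq hρ (t.extends_snoc v hv) hn] at this
    · intro h s' hs'
      have : Nonempty {t : K.Path // s'.Extends t ∧ n < t.length} := by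
        obtain ⟨r, h₁, h₂, _⟩ := s'.exists_extends_last_eq n
        exact ⟨r, h₁, h₂⟩
      have hinf := (hsig c).iInf
        (fun (t : {t : K.Path // s'.Extends t ∧ n < t.length}) i =>
          val K (args i) t.1.last (fun x => (ρ x).1 t.1))
        (fun t => h t.1 (Path.Extends.trans hs' t.2.1) t.2.2 _ (K.le_refl _))
      convert hinf using 2
      funext i
      rw [Bool.eq_iff_iff, ih i hρ, decide_eq_true_iff]
      exact ⟨fun h t => h t.1 t.2.1 t.2.2, fun h t h₁ h₂ => h ⟨t, h₁, h₂⟩⟩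
  | all x φ ih =>
    simp only [val_all_iff]
    constructor
    · intro h t hst hn v hv d hd
      let f : K.Path → U := fun r => if r = t.snoc v hv then d else (K.D_nonempty r.last).choose
      have hf : ∀ r, f r ∈ K.D r.last := by
        intro r
        by_cases hr : r = t.snoc v hv
        · subst hr; simpa [f, Path.last_snoc] using hd
        · simpa [f, hr] using (K.D_nonempty r.last).choose_spec
      let u := Individual.ofRestrict K t.length f hf
      have hu : K.Stable t.length u.1 := Individual.stable_ofRestrict K _ f hf
      have hud : u.1 (t.snoc v hv) = d := by
        simp only [u, Individual.ofRestrict]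
        rw [Path.restrict_eq_self (by rw [Path.length_snoc])]
        simp [f]
      have := (ih (stable_update hρ x hu) _).1
        (h (t.snoc v hv) (hst.trans (t.extends_snoc v hv)) u trivial) _ (.refl _)
        (by rw [Path.length_snoc]; omega)
      rwa [eval_update, hud, eval_eq hρ (t.extends_snoc v hv) hn] at this
    · intro h s' hs' u _
      obtain ⟨m, hm⟩ := u.2.2
      rw [ih (stable_update hρ x hm)]
      intro t ht hn
      rw [eval_update]
      exact h t (Path.Extends.trans hs' ht) (by omega) _ (K.le_refl _) _ (u.2.1 t)
  | ex x φ ih =>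
    simp only [val_ex_iff]
    constructor
    · rintro ⟨u, -, hu⟩ t hst hn
      obtain ⟨m, hm⟩ := u.2.2
      obtain ⟨r, htr, hr, hl⟩ := t.exists_extends_last_eq (max n m)
      have := (ih (stable_update hρ x hm) s).1 hu r (hst.trans htr) hr
      rw [eval_update, eval_eq hρ htr hn, hl] at this
      exact ⟨u.1 r, hl ▸ u.2.1 r, this⟩
    · intro h
      have hex : ∀ t : K.Path, ∃ d ∈ K.D t.last, s.Extends t → n < t.length →
          val K φ t.last (Function.update (fun y => (ρ y).1 t) x d) = true := by
        intro t
        by_cases ht : s.Extends t ∧ n < t.length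
        · obtain ⟨d, hd, hφ⟩ := h t ht.1 ht.2
          exact ⟨d, hd, fun _ _ => hφ⟩
        · obtain ⟨d, hd⟩ := K.D_nonempty t.last
          exact ⟨d, hd, fun h₁ h₂ => absurd ⟨h₁, h₂⟩ ht⟩
      choose f hf hφ using hex
      refine ⟨Individual.ofRestrict K (max n s.length) f hf, trivial, ?_⟩
      rw [ih (stable_update hρ x (Individual.stable_ofRestrict K _ f hf))]
      intro t hst ht
      have ht' : max n s.length < t.length := by omega
      have hlen := Path.length_restrict ht'
      have hsr : s.Extends (t.restrict (max n s.length)) :=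
        hst.extends_of_length_le (t.restrict_extends _) (by omega)
      have hn : n < (t.restrict (max n s.length)).length := by omega
      have hval := hφ _ hsr hn
      rw [eval_update, eval_eq hρ (t.restrict_extends _) hn]
      exact K.val_persistent _ (t.restrict_extends _).last_le
        (update_mem (fun y => (ρ y).2.1 _) x (hf _)) hval

theorem exists_val_unfolding_eq (hsig : ∀ c : sig.Conn, Supermultiplicative (sig.tt c))
    (w : W) {ρ : ℕ → U} (hρ : ∀ x, ρ x ∈ K.D w) :
    ∃ (s : K.Path) (ρ' : ℕ → K.Individual),
      ∀ φ : Formula sig, val K.unfolding φ s ρ' = val K φ w ρ := by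
  let f : ℕ → K.Path → U := fun x r =>
    if r = Path.single w then ρ x else (K.D_nonempty r.last).choose
  have hf : ∀ x r, f x r ∈ K.D r.last := by
    intro x r
    by_cases hr : r = Path.single w
    · subst hr
      simp only [f, if_true]
      exact hρ x
    · simpa [f, hr] using (K.D_nonempty r.last).choose_spec
  let ρ' : ℕ → K.Individual := fun x => Individual.ofRestrict K 0 (f x) (hf x)
  have hstable : ∀ x, K.Stable 0 (ρ' x).1 := fun x =>
    Individual.stable_ofRestrict K _ (f x) (hf x)
  have heval : (fun x => (ρ' x).1 (Path.single w)) = ρ := by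
    funext x
    simp only [ρ', Individual.ofRestrict]
    rw [Path.restrict_eq_self (by simp [Path.single, Path.length])]
    simp [f]
  have hpos : 0 < (Path.single w : K.Path).length := Nat.one_pos
  refine ⟨Path.single w, ρ', fun φ => ?_⟩
  rw [Bool.eq_iff_iff, K.val_unfolding_iff hsig φ hstable]
  constructor
  · intro h
    have := h _ (.refl _) hpos
    rwa [heval] at this
  · intro h t ht _
    rw [eval_eq hstable ht hpos, heval]
    exact K.val_persistent φ ht.last_le hρ h

/-- A two-world model over the individuals `false` and `true`, of which `true` exists only at
the later world. -/
def growing (sig : Signature) : Kripke sig Bool Bool where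
  le w v := w ≤ v
  le_refl _ := _root_.le_refl _
  le_trans h h' := _root_.le_trans h h'
  D w := {a | a ≤ w}
  D_nonempty w := ⟨w, _root_.le_refl w⟩
  D_mono h _ ha := _root_.le_trans ha h
  I _ p a := match p, a with
    | (k, 0), _ => k == 0
    | (k, _ + 1), a => if k = 0 then a 0 else !a 0
  hered _ _ _ _ := le_rfl

end Kripke

/-- An atomic formula determined by two bits: a nullary atom if they agree, and one of two
unary atoms in the variable `0` if they differ. -/
def splitAtom (sig : Signature) : Bool → Bool → Formula sig
  | true, true => .atom (0, 0) (fun _ => 0)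
  | true, false => .atom (0, 1) (fun _ => 0)
  | false, true => .atom (1, 1) (fun _ => 0)
  | false, false => .atom (1, 0) (fun _ => 0)

/-- The premises of the sequent separating `FOILS` from `FOCDS`. -/
def splitLeft (sig : Signature) (c : sig.Conn) (a b : Fin (sig.arity c) → Bool) :
    Set (Formula sig) :=
  {splitAtom sig true true, .all 0 (.conn c fun i => splitAtom sig (a i) (b i))}

/-- The conclusions of the sequent separating `FOILS` from `FOCDS`. -/
def splitRight (sig : Signature) : Set (Formula sig) :=
  {splitAtom sig false false, .ex 0 (splitAtom sig true false),
    .all 0 (splitAtom sig false true)}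

theorem FOCDS_split {sig : Signature} {c : sig.Conn} {a b : Fin (sig.arity c) → Bool}
    (h : sig.tt c (fun i => a i && b i) = false) :
    FOCDS sig (splitLeft sig c a b) (splitRight sig) := by
  rintro W U K hK w ρ hρ ⟨hl, hr⟩
  simp only [splitLeft, splitRight, Set.mem_insert_iff, Set.mem_singleton_iff, forall_eq_or_imp,
    forall_eq, ← Bool.not_eq_true, Kripke.val_all_iff, Kripke.val_ex_iff,
    Kripke.val_conn_iff] at hl hr
  obtain ⟨hT, hc⟩ := hl
  obtain ⟨hF, hp, hq⟩ := hr
  refine hq fun v hv d hd => ?_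
  rw [← hK w v] at hd
  have hρd := Kripke.update_mem hρ 0 hd
  refine K.val_persistent _ hv hρd ?_
  by_contra hqd
  refine absurd (hc w (K.le_refl w) d hd w (K.le_refl w)) ?_
  rw [Bool.not_eq_true, ← h]
  congr 1
  funext i
  have hT' : val K (splitAtom sig true true) w (Function.update ρ 0 d) = true := by
    exact (K.val_atom_nullary _ _ _ _ _).trans hT
  have hF' : val K (splitAtom sig false false) w (Function.update ρ 0 d) = false := by
    rw [Bool.not_eq_true] at hF
    exact (K.val_atom_nullary _ _ _ _ _).trans hF
  have hp' : val K (splitAtom sig true false) w (Function.update ρ 0 d) = false := by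
    rw [← Bool.not_eq_true]
    exact fun hpd => hp ⟨d, hd, hpd⟩
  rw [Bool.not_eq_true] at hqd
  cases a i <;> cases b i <;> assumption

theorem not_FOILS_split {sig : Signature} {c : sig.Conn} {a b : Fin (sig.arity c) → Bool}
    (ha : sig.tt c a = true) (hb : sig.tt c b = true) :
    ¬ FOILS sig (splitLeft sig c a b) (splitRight sig) := by
  intro h
  have hval : ∀ (p q w : Bool) (ρ : ℕ → Bool),
      val (Kripke.growing sig) (splitAtom sig p q) w ρ = if ρ 0 then p else q := by
    intro p q w ρ
    cases p <;> cases q <;> cases hρ : ρ 0 <;>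
      simp [splitAtom, Kripke.val_atom, Kripke.growing, hρ]
  refine h Bool Bool (Kripke.growing sig) false (fun _ => false) (fun _ => le_refl false) ?_
  simp only [splitLeft, splitRight, Set.mem_insert_iff, Set.mem_singleton_iff, forall_eq_or_imp,
    forall_eq, ← Bool.not_eq_true, Kripke.val_all_iff, Kripke.val_ex_iff,
    Kripke.val_conn_iff, hval, Function.update_self]
  refine ⟨⟨by simp, fun v _ d _ u _ => ?_⟩, by simp, ?_, ?_⟩
  · cases d
    · simpa using hb
    · simpa using ha
  · simp [Kripke.growing]
  · intro hq
    exact absurd (hq true (Bool.false_le _) true (le_refl true)) (by simp)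

/-- For any set of propositional connectives `C` (a signature),
`FOILS(C) = FOCDS(C)` if and only if every connective in `C` is
supermultiplicative. -/
theorem FOILS_eq_FOCDS_iff_supermultiplicative (sig : Signature) :
    (∀ Γ Δ : Set (Formula sig), FOILS sig Γ Δ ↔ FOCDS sig Γ Δ) ↔
      ∀ c : sig.Conn, Supermultiplicative (sig.tt c) := by
  constructor
  · intro h c a b ha hb
    by_contra hab
    exact not_FOILS_split ha hb ((h _ _).2 (FOCDS_split (Bool.not_eq_true _ ▸ hab)))
  · intro hsig Γ Δ
    refine ⟨fun h W U K _ => h W U K, fun h W U K w ρ hρ => ?_⟩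
    obtain ⟨s, ρ', hval⟩ := K.exists_val_unfolding_eq hsig w hρ
    simpa only [hval] using
      h _ _ K.unfolding K.constantDomain_unfolding s ρ' (fun _ => trivial)
end

section
/- If the set C of connectives contains some connective c that is not supermultiplicative, then FOILS(C) ≠ FOCDS(C); that is, there exists a sequent over C which is valid in all constant domain Kripke models but not valid in all Kripke models. -/
open Classical

open Classical

/-- The unary atomic formula `pₖ(x)`. -/
def unaryAtom (sig : Signature) (k x : ℕ) : Formula sig :=
  .atom (k, 1) fun _ => x

/-- The application of `c` to atoms in which the `i`-th argument is `p₀(y)`, `p₂(x)`, `p₃(x)` or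
`p₁(y)`, with `x` and `y` the variables `0` and `1`, according as `(a i, b i)` is `(1,1)`, `(1,0)`,
`(0,1)` or `(0,0)`. -/
def mixedConn (sig : Signature) (c : sig.Conn) (a b : Fin (sig.arity c) → Bool) : Formula sig :=
  .conn c fun i =>
    if a i then (if b i then unaryAtom sig 0 1 else unaryAtom sig 2 0)
    else (if b i then unaryAtom sig 3 0 else unaryAtom sig 1 1)

/-- The two-world model with domains `{0} ⊆ {0,1}` in which `p₀` holds everywhere, `p₂` holds
exactly of `1`, `p₃` exactly of `0`, and every other unary predicate nowhere. -/
noncomputable def growingModel (sig : Signature) : Kripke sig Bool Bool where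
  le := (· ≤ ·)
  le_refl := le_refl
  le_trans := le_trans
  D w := {u | u ≤ w}
  D_nonempty w := ⟨w, le_refl w⟩
  D_mono h _ hu := le_trans hu h
  I _ p a := decide (p.1 = 0 ∨ (p.1 = 2 ∧ ∃ i, a i = true) ∨ (p.1 = 3 ∧ ∀ i, a i = false))
  hered _ _ _ _ := le_refl _

/-- In a constant domain model, `p₀(y), ∀x mixedConn ⇒ p₁(y), ∃x p₂(x), ∀x p₃(x)` is valid as
soon as the truth function of `c` vanishes at `a ⊓ b`. -/
theorem FOCDS_mixedConn (sig : Signature) (c : sig.Conn) (a b : Fin (sig.arity c) → Bool)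
    (hab : sig.tt c (fun i => a i && b i) = false) :
    FOCDS sig {unaryAtom sig 0 1, .all 0 (mixedConn sig c a b)}
      {unaryAtom sig 1 1, .ex 0 (unaryAtom sig 2 0), .all 0 (unaryAtom sig 3 0)} := by
  rintro W U K hK w ρ hρ ⟨hΓ, hΔ⟩
  simp only [Set.mem_insert_iff, Set.mem_singleton_iff, forall_eq_or_imp, forall_eq] at hΓ hΔ
  obtain ⟨h₀, hconn⟩ := hΓ
  obtain ⟨h₁, h₂, h₃⟩ := hΔ
  simp only [unaryAtom, mixedConn, val, decide_eq_true_eq, decide_eq_false_iff_not, not_exists,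
    not_and, Bool.not_eq_true] at h₀ h₁ h₂ h₃ hconn
  refine h₃ fun v hv u hu => ?_
  rw [hK v w] at hu
  have hw : K.I w (3, 1) (fun _ => u) = true := by
    by_contra hq
    have hc := hconn w (K.le_refl w) u hu w (K.le_refl w)
    refine absurd hc ?_
    rw [Bool.not_eq_true, ← hab]
    congr 1
    funext i
    have hp := h₂ u hu
    cases ha : a i <;> cases hb : b i <;> simp_all [val]
  simpa using K.hered hv (3, 1) (fun _ => u) (fun _ => hu) hw

/-- The sequent `p₀(y), ∀x mixedConn ⇒ p₁(y), ∃x p₂(x), ∀x p₃(x)` fails at the smaller world of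
`growingModel` if the truth function of `c` holds at `a` and at `b`. -/
theorem not_FOILS_mixedConn (sig : Signature) (c : sig.Conn) (a b : Fin (sig.arity c) → Bool)
    (ha : sig.tt c a = true) (hb : sig.tt c b = true) :
    ¬ FOILS sig {unaryAtom sig 0 1, .all 0 (mixedConn sig c a b)}
      {unaryAtom sig 1 1, .ex 0 (unaryAtom sig 2 0), .all 0 (unaryAtom sig 3 0)} := by
  intro h
  refine h Bool Bool (growingModel sig) false (fun _ => false) (fun _ => le_refl false) ⟨?_, ?_⟩
  · simp only [Set.mem_insert_iff, Set.mem_singleton_iff, forall_eq_or_imp, forall_eq]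
    refine ⟨by simp [unaryAtom, val, growingModel], ?_⟩
    simp only [mixedConn, val, decide_eq_true_eq]
    intro v _ u _ v' _
    cases u
    · refine (congrArg _ (funext fun i => ?_)).trans hb
      cases hai : a i <;> cases hbi : b i <;> simp [unaryAtom, val, growingModel]
    · refine (congrArg _ (funext fun i => ?_)).trans ha
      cases hai : a i <;> cases hbi : b i <;> simp [unaryAtom, val, growingModel]
  · simp [unaryAtom, val, growingModel]

/-- If `C` contains a connective that is not supermultiplicative,
then `FOILS(C) ≠ FOCDS(C)`: some sequent over `C` is valid in all constant
domain Kripke models but not in all Kripke models. -/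
theorem FOILS_ne_FOCDS_of_not_supermultiplicative (sig : Signature)
    (c : sig.Conn) (hc : ¬ Supermultiplicative (sig.tt c)) :
    ∃ Γ Δ : Set (Formula sig), FOCDS sig Γ Δ ∧ ¬ FOILS sig Γ Δ := by
  simp only [Supermultiplicative, not_forall, Bool.not_eq_true] at hc
  obtain ⟨a, b, ha, hb, hab⟩ := hc
  exact ⟨_, _, FOCDS_mixedConn sig c a b hab, not_FOILS_mixedConn sig c a b ha hb⟩
end

section
/- Let C be any set of propositional connectives. Then FOCDS(C) = FOCLS(C) if and only if every connective in C is monotonic. -/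
open Classical

open Classical

/-- The hereditary condition extends from atomic formulas to all formulas. -/
theorem val_persistent {sig : Signature} {W U : Type} (K : Kripke sig W U) (φ : Formula sig) :
    ∀ (w v : W) (ρ : ℕ → U), K.le w v → (∀ x, ρ x ∈ K.D w) →
      val K φ w ρ = true → val K φ v ρ = true := by
  induction φ with
  | atom p args =>
    intro w v ρ hwv hρ h
    exact K.hered hwv p _ (fun i => hρ (args i)) h
  | conn c args ih =>
    intro w v ρ hwv hρ h
    simp only [val, decide_eq_true_eq] at h ⊢
    exact fun u hvu => h u (K.le_trans hwv hvu)
  | all x φ ih =>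
    intro w v ρ hwv hρ h
    simp only [val, decide_eq_true_eq] at h ⊢
    exact fun u hvu => h u (K.le_trans hwv hvu)
  | ex x φ ih =>
    intro w v ρ hwv hρ h
    simp only [val, decide_eq_true_eq] at h ⊢
    obtain ⟨a, ha, h⟩ := h
    refine ⟨a, K.D_mono hwv ha, ih w v _ hwv (fun y => ?_) h⟩
    by_cases hy : y = x
    · subst hy; simpa using ha
    · simpa [hy] using hρ y

/-- The one-world model consisting of a single world of `K`. -/
def Kripke.atWorld {sig : Signature} {W U : Type} (K : Kripke sig W U) (w : W) :
    Kripke sig Unit U where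
  le _ _ := True
  le_refl _ := trivial
  le_trans _ _ := trivial
  D _ := K.D w
  D_nonempty _ := K.D_nonempty w
  D_mono _ := subset_rfl
  I _ := K.I w
  hered _ _ _ _ := le_rfl

/-- In a constant domain model over monotonic connectives, the value of a formula at a world
is its classical value in that world. -/
theorem val_atWorld {sig : Signature} (hmono : ∀ c : sig.Conn, Monotonic (sig.tt c))
    {W U : Type} (K : Kripke sig W U) (hK : ConstantDomain K) (w : W) (φ : Formula sig) :
    ∀ ρ : ℕ → U, (∀ x, ρ x ∈ K.D w) → val (K.atWorld w) φ () ρ = val K φ w ρ := by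
  have hupdate : ∀ (ρ : ℕ → U) (x : ℕ) (a : U), (∀ y, ρ y ∈ K.D w) → a ∈ K.D w →
      ∀ y, Function.update ρ x a y ∈ K.D w := by
    intro ρ x a hρ ha y
    by_cases hy : y = x
    · subst hy; simpa using ha
    · simpa [hy] using hρ y
  induction φ with
  | atom p args => intro ρ hρ; rfl
  | conn c args ih =>
    intro ρ hρ
    rw [Bool.eq_iff_iff]
    simp only [val, decide_eq_true_eq]
    have hargs : (fun i => val (K.atWorld w) (args i) () ρ) = fun i => val K (args i) w ρ :=
      funext fun i => ih i ρ hρ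
    constructor
    · intro h v hwv
      have hw := h () trivial
      rw [hargs] at hw
      exact hmono c _ _ (fun i => val_persistent K (args i) w v ρ hwv hρ) hw
    · intro h v _
      rw [hargs]
      exact h w (K.le_refl w)
  | all x φ ih =>
    intro ρ hρ
    rw [Bool.eq_iff_iff]
    simp only [val, decide_eq_true_eq]
    constructor
    · intro h v hwv a ha
      have haw : a ∈ K.D w := by rwa [hK w v]
      have hw := h () trivial a haw
      rw [ih _ (hupdate ρ x a hρ haw)] at hw
      exact val_persistent K φ w v _ hwv (hupdate ρ x a hρ haw) hw
    · intro h v _ a ha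
      rw [ih _ (hupdate ρ x a hρ ha)]
      exact h w (K.le_refl w) a ha
  | ex x φ ih =>
    intro ρ hρ
    rw [Bool.eq_iff_iff]
    simp only [val, decide_eq_true_eq]
    exact exists_congr fun a => and_congr_right fun ha => by
      rw [ih _ (hupdate ρ x a hρ ha)]

/-- The two-world chain in which the `i`-th nullary predicate symbol has value `a i` at the
lower world and `b i` at the upper one. -/
def Kripke.chain (sig : Signature) {n : ℕ} (a b : Fin n → Bool) (hab : ∀ i, a i ≤ b i) :
    Kripke sig Bool Unit where
  le w v := w ≤ v
  le_refl _ := le_rfl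
  le_trans h₁ h₂ := _root_.le_trans h₁ h₂
  D _ := Set.univ
  D_nonempty _ := Set.univ_nonempty
  D_mono _ := subset_rfl
  I w p _ := if h : p.1 < n then (if w then b ⟨p.1, h⟩ else a ⟨p.1, h⟩) else false
  hered := by
    intro w v hwv p _ _
    by_cases h : p.1 < n
    · have := hab ⟨p.1, h⟩
      cases w <;> cases v <;> simp_all [Bool.le_iff_imp]
    · simp [h]

/-- For any set of propositional connectives `C`,
`FOCDS(C) = FOCLS(C)` if and only if every connective in `C` is monotonic. -/
theorem FOCDS_eq_FOCLS_iff_monotonic (sig : Signature) :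
    (∀ Γ Δ : Set (Formula sig), FOCDS sig Γ Δ ↔ FOCLS sig Γ Δ) ↔
      ∀ c : sig.Conn, Monotonic (sig.tt c) := by
  constructor
  · intro heq c a b hab
    by_contra hlt
    obtain ⟨hfa, hfb⟩ : sig.tt c a = true ∧ sig.tt c b = false := by
      revert hlt
      cases sig.tt c a <;> cases sig.tt c b <;> simp
    let p : Fin (sig.arity c) → Formula sig := fun i => .atom (i.1, 0) Fin.elim0
    have hclassical : FOCLS sig {φ | ∃ i, a i = true ∧ φ = p i}
        (insert (.conn c p) {φ | ∃ i, a i = false ∧ φ = p i}) := by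
      rintro U K ⟨⟩ ρ hρ ⟨hΓ, hΔ⟩
      have hp : (fun i => val K (p i) () ρ) = a := by
        funext i
        cases hi : a i
        · exact hΔ _ (Or.inr ⟨i, hi, rfl⟩)
        · exact hΓ _ ⟨i, hi, rfl⟩
      have hφ := hΔ _ (Or.inl rfl)
      simp only [val, decide_eq_false_iff_not] at hφ
      exact hφ fun _ _ => by rw [hp, hfa]
    have hlow : ∀ i ρ, val (Kripke.chain sig a b hab) (p i) false ρ = a i := by
      intro i ρ
      simp [p, val, Kripke.chain]
    have hup : ∀ i ρ, val (Kripke.chain sig a b hab) (p i) true ρ = b i := by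
      intro i ρ
      simp [p, val, Kripke.chain]
    refine (heq _ _).2 hclassical Bool Unit (Kripke.chain sig a b hab) (fun _ _ => rfl)
      false (fun _ => ()) (fun _ => Set.mem_univ _) ⟨?_, ?_⟩
    · rintro _ ⟨i, hi, rfl⟩
      rw [hlow, hi]
    · rintro _ (rfl | ⟨i, hi, rfl⟩)
      · simp only [val, decide_eq_false_iff_not]
        intro h
        have ht := h true (Bool.false_le true)
        simp only [hup, hfb] at ht
        exact Bool.false_ne_true ht
      · rw [hlow, hi]
  · intro hmono Γ Δ
    constructor
    · exact fun h U K => h Unit U K fun _ _ => rfl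
    · rintro h W U K hK w ρ hρ ⟨hΓ, hΔ⟩
      refine h U (K.atWorld w) () ρ hρ ⟨fun φ hφ => ?_, fun φ hφ => ?_⟩
      · rw [val_atWorld hmono K hK w φ ρ hρ, hΓ φ hφ]
      · rw [val_atWorld hmono K hK w φ ρ hρ, hΔ φ hφ]
end

section
/- Let C be any set of propositional connectives. Then FOILS(C) = FOCLS(C) if and only if every connective in C is both monotonic and supermultiplicative. -/
open Classical

open Classical

section Semantics

variable {sig : Signature} {W U : Type} {K : Kripke sig W U}

theorem val_conn {c : sig.Conn} {args : Fin (sig.arity c) → Formula sig} {w : W} {ρ : ℕ → U} :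
    val K (.conn c args) w ρ = true ↔
      ∀ v, K.le w v → sig.tt c (fun i => val K (args i) v ρ) = true := by
  simp [val]

theorem val_all {x : ℕ} {φ : Formula sig} {w : W} {ρ : ℕ → U} :
    val K (.all x φ) w ρ = true ↔
      ∀ v, K.le w v → ∀ a ∈ K.D v, val K φ v (Function.update ρ x a) = true := by
  simp [val]

theorem val_ex {x : ℕ} {φ : Formula sig} {w : W} {ρ : ℕ → U} :
    val K (.ex x φ) w ρ = true ↔ ∃ a ∈ K.D w, val K φ w (Function.update ρ x a) = true := by
  simp [val]

theorem forall_update_mem {S : Set U} {ρ : ℕ → U} (hρ : ∀ x, ρ x ∈ S) (x : ℕ) {a : U}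
    (ha : a ∈ S) (y : ℕ) : Function.update ρ x a y ∈ S := by
  rcases eq_or_ne y x with rfl | h
  · simpa using ha
  · simpa [h] using hρ y

/-- Truth of formulas persists along the order of a Kripke model. -/
theorem val_persist (φ : Formula sig) {w v : W} (hwv : K.le w v) (ρ : ℕ → U)
    (hρ : ∀ x, ρ x ∈ K.D w) (h : val K φ w ρ = true) : val K φ v ρ = true := by
  induction φ generalizing w v ρ with
  | atom p args =>
    simp only [val] at h ⊢
    have := K.hered hwv p (fun i => ρ (args i)) (fun i => hρ _)
    rw [h] at this
    exact Bool.eq_true_of_true_le this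
  | conn c args ih =>
    rw [val_conn] at h ⊢
    exact fun u hu => h u (K.le_trans hwv hu)
  | all x φ ih =>
    rw [val_all] at h ⊢
    exact fun u hu => h u (K.le_trans hwv hu)
  | ex x φ ih =>
    rw [val_ex] at h ⊢
    obtain ⟨a, ha, h⟩ := h
    exact ⟨a, K.D_mono hwv ha, ih hwv _ (forall_update_mem hρ x ha) h⟩

theorem val_conn_unit {K : Kripke sig Unit U} {c : sig.Conn}
    {args : Fin (sig.arity c) → Formula sig} {ρ : ℕ → U} :
    val K (.conn c args) () ρ = sig.tt c (fun i => val K (args i) () ρ) := by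
  rw [Bool.eq_iff_iff, val_conn]
  exact ⟨fun h => h () (K.le_refl _), fun h _ _ => h⟩

end Semantics

section Countermodels

variable {sig : Signature}

/-- A two-world model with growing domain `{0} ⊂ {0, 1}`, in which symbol family `0` is true,
`1` is false, `2` holds at the top world only, and `3` holds of the element `0` only. -/
def twoWorlds (sig : Signature) : Kripke sig Bool Bool where
  le w v := w ≤ v
  le_refl := le_refl
  le_trans := le_trans
  D w := {a | a ≤ w}
  D_nonempty w := ⟨w, le_refl w⟩
  D_mono h _ ha := le_trans ha h
  I w p a :=
    match p.1 with
    | 0 => true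
    | 2 => w
    | 3 => decide (∀ i, a i = false)
    | _ => false
  hered := by
    intro w v h p a _
    split <;> simp_all

/-- Arguments for a connective that classically range over the truth values of the rows `a`, `b`
and `a ⊓ b` as the atoms `p` and `q(x)` vary. -/
def mixedArgs (sig : Signature) {n : ℕ} (a b : Fin n → Bool) (i : Fin n) : Formula sig :=
  bif a i then
    bif b i then .atom (0, 0) Fin.elim0 else .atom (2, 0) Fin.elim0
  else
    bif b i then .atom (3, 1) (fun _ => 0) else .atom (1, 0) Fin.elim0

theorem val_mixedArgs {W U : Type} {K : Kripke sig W U} {n : ℕ} (a b : Fin n → Bool) (w : W)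
    (ρ : ℕ → U) (hr : val K (.atom (0, 0) Fin.elim0) w ρ = true)
    (hs : val K (.atom (1, 0) Fin.elim0) w ρ = false) :
    (fun i => val K (mixedArgs sig a b i) w ρ) =
      fun i => (a i && b i) || (a i && val K (.atom (2, 0) Fin.elim0) w ρ) ||
        (b i && val K (.atom (3, 1) (fun _ => 0)) w ρ) := by
  funext i
  unfold mixedArgs
  cases a i <;> cases b i <;> simp [hr, hs]

theorem val_atom_nullary {W U : Type} {K : Kripke sig W U} (k : ℕ) (w : W) (ρ σ : ℕ → U) :
    val K (.atom (k, 0) Fin.elim0) w ρ = val K (.atom (k, 0) Fin.elim0) w σ := by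
  simp only [val]
  congr 1
  funext i
  exact i.elim0

theorem monotonic_of_FOCLS_le (h : ∀ Γ Δ : Set (Formula sig), FOCLS sig Γ Δ → FOILS sig Γ Δ)
    (c : sig.Conn) : Monotonic (sig.tt c) := by
  intro a b hab
  by_contra hlt
  have ha : sig.tt c a = true := by
    cases h1 : sig.tt c a <;> simp_all
  have hb : sig.tt c b = false := by
    cases h1 : sig.tt c b <;> simp_all
  have hA : ∀ i, (b i && a i) = a i := fun i => by
    have := hab i
    revert this
    cases a i <;> cases b i <;> simp
  let Γ : Set (Formula sig) := {.atom (0, 0) Fin.elim0}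
  let Δ : Set (Formula sig) :=
    {.atom (1, 0) Fin.elim0, .atom (2, 0) Fin.elim0, .conn c (mixedArgs sig b a)}
  have hC : FOCLS sig Γ Δ := by
    rintro U K ⟨⟩ ρ hρ ⟨hΓ, hΔ⟩
    have hr := hΓ _ rfl
    have hs := hΔ (.atom (1, 0) Fin.elim0) (by simp [Δ])
    have hp := hΔ (.atom (2, 0) Fin.elim0) (by simp [Δ])
    have hc := hΔ (.conn c (mixedArgs sig b a)) (by simp [Δ])
    rw [val_conn_unit, val_mixedArgs b a () ρ hr hs, hp] at hc
    simp only [hA, Bool.and_false, Bool.or_false] at hc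
    have : (fun i => a i || (a i && val K (.atom (3, 1) (fun _ => 0)) () ρ)) = a := by
      funext i; cases a i <;> simp
    rw [this, ha] at hc
    cases hc
  refine h Γ Δ hC Bool Bool (twoWorlds sig) false (fun _ => false) (fun _ => le_refl false) ⟨?_, ?_⟩
  · rintro φ rfl
    rfl
  · rintro φ (rfl | rfl | rfl)
    · rfl
    · rfl
    · rw [← Bool.not_eq_true, val_conn]
      intro hall
      have h1 := hall true (Bool.false_le _)
      rw [val_mixedArgs b a true _ rfl rfl] at h1
      have : (fun i => (b i && a i) ||
          (b i && val (twoWorlds sig) (.atom (2, 0) Fin.elim0) true (fun _ => false)) ||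
          (a i && val (twoWorlds sig) (.atom (3, 1) (fun _ => 0)) true (fun _ => false))) = b := by
        funext i
        have h2 : val (twoWorlds sig) (.atom (2, 0) Fin.elim0) true (fun _ => false) = true := rfl
        have := hab i
        revert this
        rw [h2]
        cases a i <;> cases b i <;> simp
      rw [this, hb] at h1
      cases h1

theorem supermultiplicative_of_FOCLS_le
    (h : ∀ Γ Δ : Set (Formula sig), FOCLS sig Γ Δ → FOILS sig Γ Δ)
    (c : sig.Conn) : Supermultiplicative (sig.tt c) := by
  have hmono := monotonic_of_FOCLS_le h c
  intro a b ha hb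
  by_contra hab
  let Γ : Set (Formula sig) := {.atom (0, 0) Fin.elim0, .all 0 (.conn c (mixedArgs sig a b))}
  let Δ : Set (Formula sig) :=
    {.atom (1, 0) Fin.elim0, .atom (2, 0) Fin.elim0, .all 0 (.atom (3, 1) (fun _ => 0))}
  have hC : FOCLS sig Γ Δ := by
    rintro U K ⟨⟩ ρ hρ ⟨hΓ, hΔ⟩
    have hr := hΓ (.atom (0, 0) Fin.elim0) (by simp [Γ])
    have hA := hΓ (.all 0 (.conn c (mixedArgs sig a b))) (by simp [Γ])
    have hs := hΔ (.atom (1, 0) Fin.elim0) (by simp [Δ])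
    have hp := hΔ (.atom (2, 0) Fin.elim0) (by simp [Δ])
    have hq := hΔ (.all 0 (.atom (3, 1) (fun _ => 0))) (by simp [Δ])
    rw [← Bool.not_eq_true] at hq
    refine hq (val_all.2 fun _ hv d hd => ?_)
    by_contra hqd
    rw [Bool.not_eq_true] at hqd
    have h1 := val_all.1 hA () hv d hd
    rw [val_conn_unit, val_mixedArgs a b () _ ((val_atom_nullary ..).trans hr)
      ((val_atom_nullary ..).trans hs), hqd, (val_atom_nullary ..).trans hp] at h1
    simp only [Bool.and_false, Bool.or_false] at h1
    exact hab h1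
  refine h Γ Δ hC Bool Bool (twoWorlds sig) false (fun _ => false) (fun _ => le_refl false) ⟨?_, ?_⟩
  · rintro φ (rfl | rfl)
    · rfl
    · refine val_all.2 fun v _ d hd => val_conn.2 fun u hu => ?_
      rw [val_mixedArgs a b u _ rfl rfl]
      have h2 : ∀ ρ, val (twoWorlds sig) (.atom (2, 0) Fin.elim0) u ρ = u := fun _ => rfl
      have h3 : val (twoWorlds sig) (.atom (3, 1) (fun _ => 0)) u
          (Function.update (fun _ => false) 0 d) = !d := by
        cases d <;> simp [val, twoWorlds]
      rw [h2, h3]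
      have hdu : d ≤ u := le_trans hd hu
      clear hd hu h2 h3
      cases u
      · obtain rfl : d = false := Bool.eq_false_of_le_false hdu
        have := hmono b (fun i => (a i && b i) || (a i && false) || (b i && !false))
          (fun i => by cases a i <;> cases b i <;> simp)
        rw [hb] at this
        exact Bool.eq_true_of_true_le this
      · have := hmono a (fun i => (a i && b i) || (a i && true) || (b i && !d))
          (fun i => by cases a i <;> cases b i <;> simp)
        rw [ha] at this
        exact Bool.eq_true_of_true_le this
  · rintro φ (rfl | rfl | rfl)
    · rfl
    · rfl
    · rw [← Bool.not_eq_true, val_all]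
      intro hall
      have := hall true (Bool.false_le _) true (le_refl true)
      simp [val, twoWorlds] at this

end Countermodels

section Collapse

variable {sig : Signature} {W U : Type}

/-- A monotonic and supermultiplicative truth function that takes the value `1` is the conjunction
of some of its arguments. -/
theorem exists_eq_true_iff_forall_mem {n : ℕ} {f : (Fin n → Bool) → Bool} (hm : Monotonic f)
    (hs : Supermultiplicative f) {a₀ : Fin n → Bool} (h₀ : f a₀ = true) :
    ∃ S : Set (Fin n), ∀ a, f a = true ↔ ∀ i ∈ S, a i = true := by
  have key : ∀ T : Finset (Fin n → Bool), (∀ a ∈ T, f a = true) →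
      ∃ b, f b = true ∧ ∀ a ∈ T, ∀ i, b i = true → a i = true := by
    intro T
    induction T using Finset.induction_on with
    | empty => exact fun _ => ⟨a₀, h₀, by simp⟩
    | insert c T _ ih =>
      intro hT
      obtain ⟨b, hb, hbT⟩ := ih fun a ha => hT a (Finset.mem_insert_of_mem ha)
      refine ⟨_, hs c b (hT c (Finset.mem_insert_self ..)) hb, fun a ha i hi => ?_⟩
      rw [Bool.and_eq_true] at hi
      rcases Finset.mem_insert.1 ha with rfl | ha
      · exact hi.1
      · exact hbT a ha i hi.2
  obtain ⟨b, hb, hle⟩ := key (Finset.univ.filter fun a => f a = true) (by simp)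
  refine ⟨{i | b i = true}, fun a => ⟨fun ha i hi => hle a (by simp [ha]) i hi, fun ha => ?_⟩⟩
  have := hm b a fun i => by
    cases hbi : b i
    · exact Bool.false_le _
    · rw [ha i hbi]
  rw [hb] at this
  exact Bool.eq_true_of_true_le this

/-- Infinite ascending sequences of worlds from `w`, each with a chosen element of its domain. -/
def Run (K : Kripke sig W U) (w : W) : Type :=
  {c : ℕ → W × U // (c 0).1 = w ∧ (∀ n, K.le (c n).1 (c (n + 1)).1) ∧ ∀ n, (c n).2 ∈ K.D (c n).1}

variable {K : Kripke sig W U} {w : W}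

/-- The world reached by a run after `n` steps. -/
def Run.world (c : Run K w) (n : ℕ) : W := (c.1 n).1

theorem Run.world_mono (c : Run K w) {n m : ℕ} (h : n ≤ m) : K.le (c.world n) (c.world m) := by
  induction m, h using Nat.le_induction with
  | base => exact K.le_refl _
  | succ m _ ih => exact K.le_trans ih (c.2.2.1 m)

/-- The run that follows `c` for `n` steps, then moves to `u` with element `a` and stays there. -/
def Run.splice (c : Run K w) (n : ℕ) (u : W) (a : U) (hu : K.le (c.world n) u) (ha : a ∈ K.D u) :
    Run K w :=
  ⟨fun i => if i ≤ n then c.1 i else (u, a), by simpa using c.2.1, fun i => by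
    rcases lt_trichotomy i n with h | rfl | h
    · simpa [h.le, Nat.succ_le_of_lt h] using c.2.2.1 i
    · simpa [Run.world] using hu
    · simpa [h.not_ge, (h.trans (Nat.lt_succ_self i)).not_ge] using K.le_refl u, fun i => by
    by_cases h : i ≤ n
    · simpa [h] using c.2.2.2 i
    · simpa [h] using ha⟩

/-- `HasLevel n F`: the value of `F` at a run is determined by its first `n` steps and exists at
the world then reached. -/
def HasLevel (n : ℕ) (F : Run K w → U) : Prop :=
  (∀ c, F c ∈ K.D (c.world n)) ∧ ∀ c c' : Run K w, (∀ i ≤ n, c.1 i = c'.1 i) → F c = F c'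

theorem HasLevel.mono {n m : ℕ} (h : n ≤ m) {F : Run K w → U} (hF : HasLevel n F) :
    HasLevel m F :=
  ⟨fun c => K.D_mono (c.world_mono h) (hF.1 c),
    fun c c' hc => hF.2 c c' fun i hi => hc i (hi.trans h)⟩

theorem HasLevel.splice {n : ℕ} {F : Run K w → U} (hF : HasLevel n F) (c : Run K w) (u : W) (a : U)
    (hu : K.le (c.world n) u) (ha : a ∈ K.D u) : F (c.splice n u a hu ha) = F c :=
  hF.2 _ _ fun i hi => by simp [Run.splice, hi]

theorem Run.world_splice (c : Run K w) {n m : ℕ} (h : n < m) (u : W) (a : U)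
    (hu : K.le (c.world n) u) (ha : a ∈ K.D u) : (c.splice n u a hu ha).world m = u := by
  simp [Run.world, Run.splice, h.not_ge]

/-- Truth of a persistent property along all runs does not depend on the level used to read it. -/
theorem forall_run_of_hasLevel {ι : Type} {A : W → (ι → U) → Prop}
    (hA : ∀ {v u a}, K.le v u → (∀ i, a i ∈ K.D v) → A v a → A u a) {n m : ℕ}
    {F : ι → Run K w → U} (hn : ∀ i, HasLevel n (F i)) (hm : ∀ i, HasLevel m (F i))
    (h : ∀ c : Run K w, A (c.world n) fun i => F i c) (c : Run K w) :
    A (c.world m) fun i => F i c := by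
  rcases le_or_gt n m with hnm | hnm
  · exact hA (c.world_mono hnm) (fun i => (hn i).1 c) (h c)
  · have := h (c.splice m (c.world m) (c.1 m).2 (K.le_refl _) (c.2.2.2 m))
    rw [c.world_splice hnm (c.world m) (c.1 m).2 (K.le_refl _) (c.2.2.2 m)] at this
    have hF : (fun i => F i (c.splice m (c.world m) (c.1 m).2 (K.le_refl _) (c.2.2.2 m))) =
        fun i => F i c := funext fun i => (hm i).splice ..
    rwa [hF] at this

theorem val_of_hasLevel {φ : Formula sig} {n m : ℕ} {ρ : ℕ → Run K w → U}
    (hn : ∀ x, HasLevel n (ρ x)) (hm : ∀ x, HasLevel m (ρ x))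
    (h : ∀ c : Run K w, val K φ (c.world n) (fun x => ρ x c) = true) (c : Run K w) :
    val K φ (c.world m) (fun x => ρ x c) = true :=
  forall_run_of_hasLevel (A := fun v a => val K φ v a = true)
    (fun hvu ha hv => val_persist φ hvu _ ha hv) hn hm h c

/-- The constant run at `w`. -/
noncomputable def Run.const (K : Kripke sig W U) (w : W) : Run K w :=
  ⟨fun _ => (w, (K.D_nonempty w).choose), rfl, fun _ => K.le_refl _,
    fun _ => (K.D_nonempty w).choose_spec⟩

/-- The classical structure whose elements are the functions on runs of finite level. -/
noncomputable def collapse (K : Kripke sig W U) (w : W) : Kripke sig Unit (Run K w → U) where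
  le _ _ := True
  le_refl _ := trivial
  le_trans _ _ := trivial
  D _ := {F | ∃ n, HasLevel n F}
  D_nonempty _ := ⟨fun c => (c.1 0).2, 0, fun c => c.2.2.2 0, fun c c' h => by simp [h 0 le_rfl]⟩
  D_mono _ := subset_rfl
  I _ p a := decide (∀ n, (∀ i, HasLevel n (a i)) →
    ∀ c : Run K w, K.I (c.world n) p (fun i => a i c) = true)
  hered _ _ _ _ := le_rfl

theorem hasLevel_update {n : ℕ} {ρ : ℕ → Run K w → U} (hρ : ∀ x, HasLevel n (ρ x)) (x : ℕ)
    {F : Run K w → U} (hF : HasLevel n F) (y : ℕ) : HasLevel n (Function.update ρ x F y) :=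
  forall_update_mem (S := {F | HasLevel n F}) hρ x hF y

theorem update_apply_run (ρ : ℕ → Run K w → U) (x : ℕ) (F : Run K w → U) (c : Run K w) :
    (fun y => Function.update ρ x F y c) = Function.update (fun y => ρ y c) x (F c) := by
  funext y
  rcases eq_or_ne y x with rfl | h
  · simp
  · simp [h]

/-- A formula holds in the collapse iff it is forced at the end of all sufficiently long runs. -/
theorem val_collapse (hC : ∀ c : sig.Conn, Monotonic (sig.tt c) ∧ Supermultiplicative (sig.tt c))
    (φ : Formula sig) (n : ℕ) (ρ : ℕ → Run K w → U) (hρ : ∀ x, HasLevel n (ρ x)) :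
    val (collapse K w) φ () ρ = true ↔
      ∀ c : Run K w, val K φ (c.world n) (fun x => ρ x c) = true := by
  induction φ generalizing n ρ with
  | atom p args =>
    simp only [val, collapse, decide_eq_true_eq]
    refine ⟨fun h => h n fun i => hρ _, fun h m hm => ?_⟩
    refine forall_run_of_hasLevel (A := fun v a => K.I v p a = true) (fun hvu ha hv => ?_)
      (fun i => hρ (args i)) hm h
    have := K.hered hvu p _ ha
    rw [hv] at this
    exact Bool.eq_true_of_true_le this
  | conn f args ih =>
    rw [val_conn_unit]
    by_cases h₀ : ∃ a, sig.tt f a = true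
    · obtain ⟨a₀, h₀⟩ := h₀
      obtain ⟨S, hS⟩ := exists_eq_true_iff_forall_mem (hC f).1 (hC f).2 h₀
      simp only [val_conn, hS]
      constructor
      · intro h c v hv i hi
        exact val_persist _ hv _ (fun x => (hρ x).1 c) ((ih i n ρ hρ).1 (h i hi) c)
      · intro h i hi
        exact (ih i n ρ hρ).2 fun c => h c _ (K.le_refl _) i hi
    · exact iff_of_false (fun h => h₀ ⟨_, h⟩) fun h =>
        h₀ ⟨_, val_conn.1 (h (Run.const K w)) _ (K.le_refl _)⟩
  | all x φ ih =>
    rw [val_all]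
    constructor
    · refine fun h c => val_all.2 fun u hu a ha => ?_
      let G : Run K w → U := fun c => (c.1 (n + 1)).2
      have hG : HasLevel (n + 1) G :=
        ⟨fun c => c.2.2.2 _, fun c c' hc => by simp [G, hc (n + 1) le_rfl]⟩
      have h1 := (ih (n + 1) _
        (hasLevel_update (fun y => (hρ y).mono (Nat.le_succ n)) x hG)).1
        (h () trivial G ⟨_, hG⟩) (c.splice n u a hu ha)
      have hGa : G (c.splice n u a hu ha) = a := by simp [G, Run.splice]
      rw [Run.world_splice _ (Nat.lt_succ_self n), update_apply_run, hGa] at h1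
      simpa only [(hρ _).splice] using h1
    · rintro h _ - F ⟨m, hF⟩
      refine (ih (max n m) _ (hasLevel_update (fun y => (hρ y).mono (le_max_left n m)) x
        (hF.mono (le_max_right n m)))).2 fun c => ?_
      rw [update_apply_run]
      exact val_all.1 (h c) _ (c.world_mono (le_max_left n m)) _
        ((hF.mono (le_max_right n m)).1 c)
  | ex x φ ih =>
    rw [val_ex]
    constructor
    · rintro ⟨F, ⟨m, hF⟩, h⟩
      have hρ' := fun y => (hρ y).mono (le_max_left n m)
      have hF' := hF.mono (le_max_right n m)
      refine val_of_hasLevel hρ' hρ fun c => val_ex.2 ⟨F c, hF'.1 c, ?_⟩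
      rw [← update_apply_run]
      exact (ih _ _ (hasLevel_update hρ' x hF')).1 h c
    · intro h
      have hw : ∀ (v : W) (σ : ℕ → U), ∃ a, val K (.ex x φ) v σ = true →
          a ∈ K.D v ∧ val K φ v (Function.update σ x a) = true := by
        intro v σ
        by_cases hv : val K (.ex x φ) v σ = true
        · obtain ⟨a, ha⟩ := val_ex.1 hv
          exact ⟨a, fun _ => ha⟩
        · exact ⟨(K.D_nonempty v).choose, fun hv' => absurd hv' hv⟩
      choose wit hwit using hw
      let F : Run K w → U := fun c => wit (c.world n) fun y => ρ y c
      have hF : HasLevel n F := by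
        refine ⟨fun c => (hwit _ _ (h c)).1, fun c c' hc => ?_⟩
        simp only [F, Run.world, hc n le_rfl, fun y => (hρ y).2 c c' hc]
      refine ⟨F, ⟨n, hF⟩, (ih n _ (hasLevel_update hρ x hF)).2 fun c => ?_⟩
      rw [update_apply_run]
      exact (hwit _ _ (h c)).2

theorem FOILS_of_FOCLS
    (hC : ∀ c : sig.Conn, Monotonic (sig.tt c) ∧ Supermultiplicative (sig.tt c))
    {Γ Δ : Set (Formula sig)} (h : FOCLS sig Γ Δ) : FOILS sig Γ Δ := by
  rintro W U K w ρ hρ ⟨hΓ, hΔ⟩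
  have hw : ∀ c : Run K w, c.world 0 = w := fun c => c.2.1
  have hlev : ∀ x, HasLevel 0 (fun _ : Run K w => ρ x) :=
    fun x => ⟨fun c => by rw [hw]; exact hρ x, fun _ _ _ => rfl⟩
  have key : ∀ φ, val (collapse K w) φ () (fun x _ => ρ x) = val K φ w ρ := by
    intro φ
    rw [Bool.eq_iff_iff, val_collapse hC φ 0 _ hlev]
    simp only [hw]
    exact ⟨fun h => h (Run.const K w), fun h _ => h⟩
  exact h _ (collapse K w) () (fun x _ => ρ x) (fun x => ⟨0, hlev x⟩)
    ⟨fun φ hφ => (key φ).trans (hΓ φ hφ), fun φ hφ => (key φ).trans (hΔ φ hφ)⟩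

end Collapse

/-- For any set of propositional connectives `C`,
`FOILS(C) = FOCLS(C)` if and only if every connective in `C` is both monotonic
and supermultiplicative. -/
theorem FOILS_eq_FOCLS_iff_monotonic_and_supermultiplicative (sig : Signature) :
    (∀ Γ Δ : Set (Formula sig), FOILS sig Γ Δ ↔ FOCLS sig Γ Δ) ↔
      ∀ c : sig.Conn, Monotonic (sig.tt c) ∧ Supermultiplicative (sig.tt c) := by
  constructor
  · intro h c
    have h' := fun Γ Δ => (h Γ Δ).2
    exact ⟨monotonic_of_FOCLS_le h' c, supermultiplicative_of_FOCLS_le h' c⟩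
  · exact fun hC Γ Δ => ⟨fun h U => h Unit U, FOILS_of_FOCLS hC⟩
end

section
/- Let p and q be unary predicate symbols and let ⊕ be the connective with truth function τ_⊕(x,y)=1 iff x ≠ y. The sequent ∀x(p(x) ⊕ q(x)) ⇒ ∀x p(x) ⊕ ∃x q(x) is valid in every constant domain Kripke model but is not valid in every Kripke model (a two-world countermodel exists). -/
open Classical

open Classical

/-- The signature whose only connective is exclusive disjunction `⊕`. -/
abbrev xorSig : Signature := ⟨Unit, fun _ => 2, fun _ a => Bool.xor (a 0) (a 1)⟩

/-- `p(x)`, where `p` is the unary predicate symbol `(0,1)` and `x` is variable `0`. -/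
abbrev pAtom : Formula xorSig := .atom (0, 1) ![0]

/-- `q(x)`, where `q` is the unary predicate symbol `(1,1)` and `x` is variable `0`. -/
abbrev qAtom : Formula xorSig := .atom (1, 1) ![0]

section Semantics

variable {W U : Type} (K : Kripke xorSig W U)

lemma val_pAtom (w : W) (ρ : ℕ → U) : val K pAtom w ρ = K.I w (0, 1) (fun _ => ρ 0) := by
  rw [val]
  congr 1
  funext i
  fin_cases i
  rfl

lemma val_qAtom (w : W) (ρ : ℕ → U) : val K qAtom w ρ = K.I w (1, 1) (fun _ => ρ 0) := by
  rw [val]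
  congr 1
  funext i
  fin_cases i
  rfl

lemma val_xor_eq_true_iff (φ ψ : Formula xorSig) (w : W) (ρ : ℕ → U) :
    val K (.conn () ![φ, ψ]) w ρ = true ↔
      ∀ v, K.le w v → (val K φ v ρ ^^ val K ψ v ρ) = true := by
  rw [val, decide_eq_true_iff]
  rfl

lemma val_all_eq_true_iff (x : ℕ) (φ : Formula xorSig) (w : W) (ρ : ℕ → U) :
    val K (.all x φ) w ρ = true ↔
      ∀ v, K.le w v → ∀ a ∈ K.D v, val K φ v (Function.update ρ x a) = true := by
  rw [val, decide_eq_true_iff]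

lemma val_ex_eq_true_iff (x : ℕ) (φ : Formula xorSig) (w : W) (ρ : ℕ → U) :
    val K (.ex x φ) w ρ = true ↔
      ∃ a ∈ K.D w, val K φ w (Function.update ρ x a) = true := by
  rw [val, decide_eq_true_iff]

/-- The antecedent says that `p` and `q` are complementary at all later worlds. -/
lemma val_all_xor_eq_true_iff (w : W) (ρ : ℕ → U) :
    val K (.all 0 (.conn () ![pAtom, qAtom])) w ρ = true ↔
      ∀ v, K.le w v → ∀ a ∈ K.D v,
        (K.I v (0, 1) (fun _ => a) ^^ K.I v (1, 1) (fun _ => a)) = true := by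
  simp only [val_all_eq_true_iff, val_xor_eq_true_iff, val_pAtom, val_qAtom,
    Function.update_self]
  exact ⟨fun h v hv a ha => h v hv a ha v (K.le_refl v),
    fun h v hv a ha u hu => h u (K.le_trans hv hu) a (K.D_mono hu ha)⟩

lemma val_all_pAtom_eq_true_iff (w : W) (ρ : ℕ → U) :
    val K (.all 0 pAtom) w ρ = true ↔
      ∀ v, K.le w v → ∀ a ∈ K.D v, K.I v (0, 1) (fun _ => a) = true := by
  simp only [val_all_eq_true_iff, val_pAtom, Function.update_self]

lemma val_ex_qAtom_eq_true_iff (w : W) (ρ : ℕ → U) :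
    val K (.ex 0 qAtom) w ρ = true ↔ ∃ a ∈ K.D w, K.I w (1, 1) (fun _ => a) = true := by
  simp only [val_ex_eq_true_iff, val_qAtom, Function.update_self]

end Semantics

/-- Two worlds `false ≤ true` with domains `{false}` and `{false, true}`, where `p` holds
exactly of `false` and every other predicate exactly of tuples that are not all `false`. -/
def expandingModel : Kripke xorSig Bool Bool where
  le := (· ≤ ·)
  le_refl := le_refl
  le_trans := le_trans
  D w := {a | a ≤ w}
  D_nonempty w := ⟨w, le_refl w⟩
  D_mono h _ ha := le_trans ha h
  I _ p a := if p.1 = 0 then decide (∀ i, a i = false) else decide (∃ i, a i = true)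
  hered _ _ _ _ := le_refl _

lemma FOCDS_xor_sequent :
    FOCDS xorSig {Formula.all 0 (.conn () ![pAtom, qAtom])}
      {Formula.conn () ![.all 0 pAtom, .ex 0 qAtom]} := by
  rintro W U K hK w ρ - ⟨hΓ, hΔ⟩
  have hxor := (val_all_xor_eq_true_iff K w ρ).1 (hΓ _ rfl)
  refine Bool.eq_false_iff.1 (hΔ _ rfl) ((val_xor_eq_true_iff K _ _ w ρ).2 fun v hv => ?_)
  by_cases hq : val K (.ex 0 qAtom) v ρ = true
  · have hp : val K (.all 0 pAtom) v ρ = false := by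
      obtain ⟨a, ha, hqa⟩ := (val_ex_qAtom_eq_true_iff K v ρ).1 hq
      refine Bool.eq_false_iff.2 fun hp => ?_
      have hpa := (val_all_pAtom_eq_true_iff K v ρ).1 hp v (K.le_refl v) a ha
      simpa [hpa, hqa] using hxor v hv a ha
    simp [hp, hq]
  · have hp : val K (.all 0 pAtom) v ρ = true := by
      refine (val_all_pAtom_eq_true_iff K v ρ).2 fun u hu a ha => ?_
      have hav : a ∈ K.D v := hK u v ▸ ha
      have hqa : K.I v (1, 1) (fun _ => a) = false := Bool.eq_false_iff.2 fun h =>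
        hq ((val_ex_qAtom_eq_true_iff K v ρ).2 ⟨a, hav, h⟩)
      have hpa : K.I v (0, 1) (fun _ => a) = true := by
        simpa [hqa] using hxor v hv a hav
      exact K.hered hu (0, 1) (fun _ => a) (fun _ => hav) hpa
    simp [hp, hq]

lemma not_FOILS_xor_sequent :
    ¬ FOILS xorSig {Formula.all 0 (.conn () ![pAtom, qAtom])}
      {Formula.conn () ![.all 0 pAtom, .ex 0 qAtom]} := by
  intro h
  refine h Bool Bool expandingModel false (fun _ => false) (fun _ => le_refl false) ⟨?_, ?_⟩
  · rintro _ rfl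
    rw [val_all_xor_eq_true_iff]
    rintro v - a -
    cases a <;> simp [expandingModel]
  · rintro _ rfl
    refine Bool.eq_false_iff.2 fun hxor => ?_
    have hor := (val_xor_eq_true_iff _ _ _ _ _).1 hxor false (le_refl false)
    have hp : val expandingModel (.all 0 pAtom) false (fun _ => false) = false := by
      refine Bool.eq_false_iff.2 fun hp => ?_
      have := (val_all_pAtom_eq_true_iff _ _ _).1 hp true (Bool.false_le true) true (le_refl true)
      simp [expandingModel] at this
    have hq : val expandingModel (.ex 0 qAtom) false (fun _ => false) = false := by
      refine Bool.eq_false_iff.2 fun hq => ?_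
      obtain ⟨a, ha, hqa⟩ := (val_ex_qAtom_eq_true_iff _ _ _).1 hq
      cases a
      · simp [expandingModel] at hqa
      · exact absurd ha (by simp [expandingModel])
    simp [hp, hq] at hor

/-- The sequent `∀x(p(x) ⊕ q(x)) ⇒ ∀x p(x) ⊕ ∃x q(x)` is valid in
every constant domain Kripke model but not valid in every Kripke model. -/
theorem xor_sequent_CD_valid_not_Kripke_valid :
    FOCDS xorSig {Formula.all 0 (.conn () ![pAtom, qAtom])}
        {Formula.conn () ![.all 0 pAtom, .ex 0 qAtom]} ∧
    ¬ FOILS xorSig {Formula.all 0 (.conn () ![pAtom, qAtom])}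
        {Formula.conn () ![.all 0 pAtom, .ex 0 qAtom]} := by
  exact ⟨FOCDS_xor_sequent, not_FOILS_xor_sequent⟩
end

section
/- Definability of the biconditional: let c be a connective of arity n with truth function τ_c, let a*, b* ∈ {0,1}^n have no index i with a*[i] = b*[i] = 0, and suppose τ_c(a*) = τ_c(b*) = 0 and τ_c(a* ⊓ b*) = τ_c(1,…,1) = 1. Let T be a 0-ary predicate symbol, and for formulas α, β define α ↔_c β := c(θ₁,…,θₙ) where θᵢ = α if a*[i]=0 and b*[i]=1, θᵢ = β if a*[i]=1 and b*[i]=0, and θᵢ = T if a*[i]=b*[i]=1. Then for every Kripke model K, every world w, and every assignment ρ with ‖T‖_{K,w}^ρ = 1: ‖α ↔_c β‖_{K,w}^ρ = 1 if and only if ‖α‖_{K,v}^ρ = ‖β‖_{K,v}^ρ for all v ⪰ w. -/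
open Classical

open Classical

/-- **definability of the biconditional.** Let `c` be a connective
of arity `n`, and `a*, b* ∈ {0,1}^n` with no index `i` such that
`a*[i] = b*[i] = 0`, such that `τ_c(a*) = τ_c(b*) = 0` and
`τ_c(a* ⊓ b*) = τ_c(1,…,1) = 1`. Let `T` be the 0-ary predicate symbol `(0,0)`
and define `α ↔_c β := c(θ₁,…,θₙ)` where `θᵢ = α` if `a*[i] = 0` (and so
`b*[i] = 1`), `θᵢ = β` if `a*[i] = 1` and `b*[i] = 0`, and `θᵢ = T` if
`a*[i] = b*[i] = 1`. Then at any world `w` of any Kripke model where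
`‖T‖_{K,w}^ρ = 1`, we have `‖α ↔_c β‖_{K,w}^ρ = 1` iff
`‖α‖_{K,v}^ρ = ‖β‖_{K,v}^ρ` for all `v ⪰ w`. -/
theorem biconditional_definability (sig : Signature) (c : sig.Conn)
    (a b : Fin (sig.arity c) → Bool)
    (hab : ∀ i, a i = true ∨ b i = true)
    (hfa : sig.tt c a = false) (hfb : sig.tt c b = false)
    (hmin : sig.tt c (fun i => a i && b i) = true)
    (hone : sig.tt c (fun _ => true) = true)
    (α β : Formula sig) {W U : Type} (K : Kripke sig W U)
    (w : W) (ρ : ℕ → U) (hρ : ∀ x, ρ x ∈ K.D w)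
    (hT : val K (Formula.atom (0, 0) ![]) w ρ = true) :
    val K (Formula.conn c (fun i =>
        if a i = false then α
        else if b i = false then β
        else Formula.atom (0, 0) ![])) w ρ = true ↔
      ∀ v, K.le w v → val K α v ρ = val K β v ρ := by
  have hTv : ∀ v, K.le w v → val K (Formula.atom (0, 0) ![]) v ρ = true := by
    intro v hv
    have h := K.hered hv (0, 0) (fun i => ρ ((![] : Fin 0 → ℕ) i)) (fun i => hρ _)
    simp only [val] at hT ⊢
    rw [hT] at h
    exact top_le_iff.mp h
  simp only [val, decide_eq_true_eq]
  refine forall₂_congr fun v hv => ?_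
  have hargs : (fun i => val K (if a i = false then α
        else if b i = false then β else Formula.atom (0, 0) ![]) v ρ) =
      fun i => if a i = false then val K α v ρ
        else if b i = false then val K β v ρ else true := by
    funext i
    split_ifs
    · rfl
    · rfl
    · exact hTv v hv
  rw [hargs]
  cases val K α v ρ <;> cases val K β v ρ
  · have : (fun i => if a i = false then false else if b i = false then false else true) =
        fun i => a i && b i := by
      funext i; cases a i <;> cases b i <;> rfl
    rw [this]; simp [hmin]
  · have : (fun i => if a i = false then false else if b i = false then true else true) = a := by
      funext i; cases a i <;> cases b i <;> rfl
    rw [this]; simp [hfa]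
  · have : (fun i => if a i = false then true else if b i = false then false else true) = b := by
      funext i; have := hab i; revert this; cases a i <;> cases b i <;> simp
    rw [this]; simp [hfb]
  · simp [hone]
end

section
/- Propositional case: for any set C of propositional connectives, ILS(C) = CLS(C) if and only if every connective in C is monotonic, where ILS(C) is the set of propositional sequents over C valid in all propositional Kripke models and CLS(C) is the set of propositional sequents over C valid in all one-world propositional Kripke models (classically valid sequents). -/
open Classical

/-- Propositional formulas over a signature, with propositional variables
indexed by `ℕ`. -/
inductive PForm (sig : Signature) : Type where
  | var (p : ℕ)
  | conn (c : sig.Conn) (args : Fin (sig.arity c) → PForm sig)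

/-- A propositional Kripke model: a pre-ordered set of worlds together with a
hereditary valuation of the propositional variables. -/
structure PKripke (sig : Signature) (W : Type) : Type where
  le : W → W → Prop
  le_refl : ∀ w, le w w
  le_trans : ∀ {w v u}, le w v → le v u → le w u
  I : W → ℕ → Bool
  hered : ∀ {w v}, le w v → ∀ p, I w p ≤ I v p

/-- The value `‖φ‖_w ∈ {0,1}` of a propositional formula at a world. -/
noncomputable def pval {sig : Signature} {W : Type} (K : PKripke sig W) :
    PForm sig → W → Bool
  | .var p, w => K.I w p
  | .conn c args, w =>
      decide (∀ v, K.le w v → sig.tt c (fun i => pval K (args i) v) = true)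

/-- A propositional sequent `Γ ⇒ Δ` (two sets of formulas) is valid in a model
if at no world do all formulas of `Γ` get value 1 and all of `Δ` value 0. -/
def PSeqValid {sig : Signature} {W : Type} (K : PKripke sig W)
    (Γ Δ : Set (PForm sig)) : Prop :=
  ∀ w : W, ¬ ((∀ φ ∈ Γ, pval K φ w = true) ∧ (∀ φ ∈ Δ, pval K φ w = false))

/-- `Γ ⇒ Δ` is valid in all propositional Kripke models (belongs to ILS). -/
def ILS (sig : Signature) (Γ Δ : Set (PForm sig)) : Prop :=
  ∀ (W : Type) (K : PKripke sig W), PSeqValid K Γ Δ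

/-- `Γ ⇒ Δ` is valid in all one-world propositional Kripke models, i.e.
classically valid (belongs to CLS). -/
def CLS (sig : Signature) (Γ Δ : Set (PForm sig)) : Prop :=
  ∀ K : PKripke sig Unit, PSeqValid K Γ Δ

theorem pval_hereditary {sig : Signature} {W : Type} (K : PKripke sig W) (φ : PForm sig)
    {w v : W} (hwv : K.le w v) : pval K φ w ≤ pval K φ v := by
  cases φ with
  | var p => exact K.hered hwv p
  | conn c args =>
    rw [Bool.le_iff_imp]
    simp only [pval, decide_eq_true_eq]
    exact fun h u hvu => h u (K.le_trans hwv hvu)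

/-- The one-world model induced by a valuation. -/
def PKripke.ofValuation (sig : Signature) (I : ℕ → Bool) : PKripke sig Unit where
  le _ _ := True
  le_refl _ := trivial
  le_trans _ _ := trivial
  I _ := I
  hered _ _ := le_rfl

theorem pval_eq_pval_ofValuation {sig : Signature} (hmono : ∀ c, Monotonic (sig.tt c))
    {W : Type} (K : PKripke sig W) (w : W) (φ : PForm sig) :
    pval K φ w = pval (PKripke.ofValuation sig (K.I w)) φ () := by
  induction φ with
  | var p => rfl
  | conn c args ih =>
    simp only [pval, decide_eq_decide, ← ih]
    constructor
    · exact fun h _ _ => h w (K.le_refl w)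
    · intro h v hwv
      exact Bool.le_iff_imp.mp
        (hmono c _ _ fun i => pval_hereditary K (args i) hwv) (h () trivial)

/-- The two-world model with worlds `false ≤ true` induced by two comparable valuations. -/
def PKripke.ofValuationPair (sig : Signature) (I J : ℕ → Bool) (hIJ : I ≤ J) :
    PKripke sig Bool where
  le := (· ≤ ·)
  le_refl _ := le_rfl
  le_trans := _root_.le_trans
  I w := bif w then J else I
  hered {w v} hwv p := by
    cases w <;> cases v
    · exact le_rfl
    · exact hIJ p
    · exact absurd hwv (by decide)
    · exact le_rfl

/-- The extension of a tuple of truth values by `false` to all variables. -/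
def extendByFalse {n : ℕ} (a : Fin n → Bool) (p : ℕ) : Bool :=
  if h : p < n then a ⟨p, h⟩ else false

theorem extendByFalse_val {n : ℕ} (a : Fin n → Bool) (i : Fin n) :
    extendByFalse a i = a i := by
  simp [extendByFalse]

theorem extendByFalse_mono {n : ℕ} {a b : Fin n → Bool} (hab : ∀ i, a i ≤ b i) :
    extendByFalse a ≤ extendByFalse b := by
  intro p
  unfold extendByFalse
  split
  · exact hab _
  · exact le_rfl

/-- The formula `c(p₀, …, pₙ₋₁)`. -/
def PForm.generic {sig : Signature} (c : sig.Conn) : PForm sig :=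
  .conn c fun i => .var i

/-- The antecedent stating that the variables selected by `a` are true. -/
def trueVars {sig : Signature} {n : ℕ} (a : Fin n → Bool) : Set (PForm sig) :=
  {φ | ∃ i, a i = true ∧ φ = .var i}

/-- The succedent consisting of the variables not selected by `a`. -/
def falseVars {sig : Signature} {n : ℕ} (a : Fin n → Bool) : Set (PForm sig) :=
  {φ | ∃ i, a i = false ∧ φ = .var i}

theorem CLS_insert_generic {sig : Signature} (c : sig.Conn) {a : Fin (sig.arity c) → Bool}
    (ha : sig.tt c a = true) :
    CLS sig (trueVars a) (insert (.generic c) (falseVars a)) := by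
  rintro K w ⟨hΓ, hΔ⟩
  have hI : (fun i : Fin (sig.arity c) => K.I w i) = a := by
    funext i
    cases h : a i
    · simpa [pval] using hΔ (.var i) (Or.inr ⟨i, h, rfl⟩)
    · simpa [pval] using hΓ (.var i) ⟨i, h, rfl⟩
  have hc := hΔ _ (Set.mem_insert _ _)
  rw [PForm.generic, pval, decide_eq_false_iff_not] at hc
  exact hc fun _ _ => (congrArg (sig.tt c) hI).trans ha

theorem not_ILS_insert_generic {sig : Signature} (c : sig.Conn)
    {a b : Fin (sig.arity c) → Bool} (hab : ∀ i, a i ≤ b i) (hb : sig.tt c b = false) :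
    ¬ ILS sig (trueVars a) (insert (.generic c) (falseVars a)) := by
  intro h
  refine h Bool (.ofValuationPair sig _ _ (extendByFalse_mono hab)) false ⟨?_, ?_⟩
  · rintro _ ⟨i, hi, rfl⟩
    simpa [pval, PKripke.ofValuationPair, extendByFalse_val] using hi
  · rintro _ (rfl | ⟨i, hi, rfl⟩)
    · rw [PForm.generic, pval, decide_eq_false_iff_not]
      intro hc
      have hc := hc true (Bool.false_le true)
      simp [pval, PKripke.ofValuationPair, extendByFalse_val, hb] at hc
    · simpa [pval, PKripke.ofValuationPair, extendByFalse_val] using hi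

/-- **propositional case.** `ILS(C) = CLS(C)` if and only if every
connective in `C` is monotonic. -/
theorem ILS_eq_CLS_iff_monotonic (sig : Signature) :
    (∀ Γ Δ : Set (PForm sig), ILS sig Γ Δ ↔ CLS sig Γ Δ) ↔
      ∀ c : sig.Conn, Monotonic (sig.tt c) := by
  constructor
  · intro h c a b hab
    rw [Bool.le_iff_imp]
    intro ha
    by_contra hb
    exact not_ILS_insert_generic c hab (Bool.eq_false_of_not_eq_true hb)
      ((h _ _).mpr (CLS_insert_generic c ha))
  · intro hmono Γ Δ
    refine ⟨fun h K => h Unit K, fun h W K w hw => ?_⟩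
    simp only [pval_eq_pval_ofValuation hmono K w] at hw
    exact h _ () hw
end
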